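/- Suppose (G,p) is a framework on some family of concentric cylinders Y with rank R_Y(G,p) = 3n − 2, and (ω,λ) is an equilibrium stress for (G,p) on Y with rank Ω_Y(ω,λ) = 3n − 6. Then for every generic point q of ℝ^{3n}, the framework (G,q) has an equilibrium stress (ω',λ') on the induced family of concentric cylinders Y^q with rank Ω_{Y^q}(ω',λ') = 3n − 6, and moreover (ω',λ') can be chosen so that ω'(e) ≠ 0 for every edge e ∈ E. -/

import Mathlib

open Finset

/-- The rigidity matrix `R_Y(G,p)` of a framework on a family of concentric cylinders:
rows indexed by (potential) edges and by vertices, columns by `Fin 3 × Fin n`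
(coordinate block × vertex).  The row of an edge `v_iv_j` carries `p_i − p_j` in the
columns of `v_i` and `p_j − p_i` in the columns of `v_j`; the row of a vertex `v_i`
carries `(x_i, y_i, 0)` in the columns of `v_i`.  Rows indexed by non-edges are zero. -/
def rigidityMatY {n : ℕ} (G : SimpleGraph (Fin n)) [DecidableRel G.Adj]
    (p : Fin n → Fin 3 → ℝ) : Matrix (Sym2 (Fin n) ⊕ Fin n) (Fin 3 × Fin n) ℝ :=
  fun row c =>
    match row with
    | Sum.inl e =>
        if e ∈ G.edgeSet then
          if h : c.2 ∈ e then p c.2 c.1 - p (Sym2.Mem.other' h) c.1 else 0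
        else 0
    | Sum.inr i => if c.2 = i ∧ c.1 ≠ 2 then p i c.1 else 0

/-- The `n×n` matrix `Ω(ω)` with off-diagonal entries `-ω i j` and diagonal entries `∑ k, ω i k`. -/
def omegaMat {n : ℕ} (ω : Fin n → Fin n → ℝ) : Matrix (Fin n) (Fin n) ℝ :=
  fun i j => if i = j then ∑ k, ω i k else -ω i j

/-- The `3n×3n` stress matrix `Ω_Y(ω,λ) = diag(Ω+Λ, Ω+Λ, Ω)` on a family of concentric
cylinders, indexed by `Fin 3 × Fin n` (coordinate block × vertex). -/
def stressMatY {n : ℕ} (ω : Fin n → Fin n → ℝ) (lam : Fin n → ℝ) :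
    Matrix (Fin 3 × Fin n) (Fin 3 × Fin n) ℝ :=
  fun r c => if r.1 = c.1 then
      omegaMat ω r.2 c.2 + (if r.2 = c.2 ∧ r.1 ≠ 2 then lam r.2 else 0)
    else 0

/-- `(ω,λ)` is an equilibrium stress for `(G,p)` on the family of concentric cylinders:
`∑_j ω_ij (p_i − p_j) + λ_i (x_i, y_i, 0) = 0` for all `i`. -/
def IsEquilStressY {n : ℕ} (p : Fin n → Fin 3 → ℝ)
    (ω : Fin n → Fin n → ℝ) (lam : Fin n → ℝ) : Prop :=
  ∀ i, ∀ a : Fin 3,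
    (∑ j, ω i j * (p i a - p j a)) + lam i * (if a = 2 then 0 else p i a) = 0

/-- `(ω,λ)` is a stress for the graph `G`: `ω` is symmetric and supported on the edges. -/
def IsStress {n : ℕ} (G : SimpleGraph (Fin n)) (ω : Fin n → Fin n → ℝ) : Prop :=
  (∀ i j, ω i j = ω j i) ∧ (∀ i j, ¬ G.Adj i j → ω i j = 0)

/-- The `6 × 3n` configuration matrix `C_Y(G,p)` for a framework on a family of
concentric cylinders, with rows `(x|0|0), (0|y|0), (0|0|z), (y|0|0), (0|x|0), (0|0|1)`. -/
def configMatY {n : ℕ} (p : Fin n → Fin 3 → ℝ) : Matrix (Fin 6) (Fin 3 × Fin n) ℝ :=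
  Matrix.of ![
    fun c => if c.1 = 0 then p c.2 0 else 0,
    fun c => if c.1 = 1 then p c.2 1 else 0,
    fun c => if c.1 = 2 then p c.2 2 else 0,
    fun c => if c.1 = 0 then p c.2 1 else 0,
    fun c => if c.1 = 1 then p c.2 0 else 0,
    fun c => if c.1 = 2 then 1 else 0]

section MatrixRank

open Matrix

variable {K l m k : Type*} [Field K] [Fintype l] [Fintype m] [Fintype k]

theorem Matrix.exists_linearIndependent_row_submatrix (A : Matrix m k K) {r : ℕ}
    (hr : A.rank = r) : ∃ f : Fin r → m, LinearIndependent K (A.submatrix f id).row := by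
  obtain ⟨v, hv, -, hli⟩ := Submodule.exists_fun_fin_finrank_span_eq K (Set.range A.row)
  rw [A.rank_eq_finrank_span_row] at hr
  subst hr
  choose f hf using hv
  have hfv : (A.submatrix f id).row = v := funext hf
  exact ⟨f, hfv ▸ hli⟩

theorem Matrix.exists_submatrix_det_ne_zero (A : Matrix m k K) :
    ∃ (f : Fin A.rank → m) (g : Fin A.rank → k), (A.submatrix f g).det ≠ 0 := by
  obtain ⟨f, hf⟩ := A.exists_linearIndependent_row_submatrix rfl
  obtain ⟨g, hg⟩ := (A.submatrix f id)ᵀ.exists_linearIndependent_row_submatrix (r := A.rank)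
    (by rw [rank_transpose, hf.rank_matrix, Fintype.card_fin])
  refine ⟨f, g, ?_⟩
  rw [← isUnit_iff_ne_zero, ← isUnit_iff_isUnit_det, ← isUnit_transpose,
    ← linearIndependent_rows_iff_isUnit]
  exact hg

omit [Fintype m] in
theorem Matrix.le_rank_of_submatrix_det_ne_zero {r : ℕ} {A : Matrix m k K} {f : Fin r → m}
    {g : Fin r → k} (h : (A.submatrix f g).det ≠ 0) : r ≤ A.rank := by
  have hle := A.rank_submatrix_le f g
  rwa [rank_of_isUnit _ ((isUnit_iff_isUnit_det _).2 h.isUnit), Fintype.card_fin] at hle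

/-- If the columns `g` of `A` span the column space of `A`, then a vector orthogonal to these
columns is orthogonal to all columns. -/
theorem Matrix.vecMul_eq_zero_of_rank_le {r : ℕ} {A : Matrix m k K} {f : Fin r → m}
    {g : Fin r → k} (h : (A.submatrix f g).det ≠ 0) (hr : A.rank ≤ r) {w : m → K}
    (hw : w ᵥ* A.submatrix id g = 0) : w ᵥ* A = 0 := by
  have hsub : Set.range (A.submatrix id g).col ⊆ Set.range A.col := by
    rintro _ ⟨i, rfl⟩
    exact ⟨g i, rfl⟩
  have hle : r ≤ (A.submatrix id g).rank :=
    le_rank_of_submatrix_det_ne_zero (f := f) (g := id) (by simpa using h)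
  have heq : Submodule.span K (Set.range (A.submatrix id g).col) =
      Submodule.span K (Set.range A.col) := by
    refine Submodule.eq_of_le_of_finrank_le (Submodule.span_mono hsub) ?_
    rw [← rank_eq_finrank_span_cols, ← rank_eq_finrank_span_cols]
    exact hr.trans hle
  have hker : Submodule.span K (Set.range (A.submatrix id g).col) ≤
      LinearMap.ker (dotProductBilin K K w) := by
    rw [Submodule.span_le]
    rintro _ ⟨i, rfl⟩
    exact congrFun hw i
  funext j
  exact hker (heq ▸ Submodule.subset_span ⟨j, rfl⟩)

theorem Matrix.rank_add_card_le_of_mul_transpose_eq_zero {A : Matrix m k K} {C : Matrix l k K}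
    (hC : LinearIndependent K C.row) (h : A * Cᵀ = 0) :
    A.rank + Fintype.card l ≤ Fintype.card k := by
  simpa [rank_transpose, hC.rank_matrix] using rank_add_rank_le_card_of_mul_eq_zero h

omit [Fintype m] in
/-- If the independent rows of `C` lie in the kernel of `A` and are sufficiently many, then they
span the kernel of `A`. -/
theorem Matrix.exists_vecMul_eq_of_mulVec_eq_zero {A : Matrix m k K} {C : Matrix l k K}
    (hC : LinearIndependent K C.row) (h : A * Cᵀ = 0)
    (hr : Fintype.card k ≤ A.rank + Fintype.card l) {u : k → K} (hu : A *ᵥ u = 0) :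
    ∃ c : l → K, c ᵥ* C = u := by
  have hle : LinearMap.range C.vecMulLinear ≤ LinearMap.ker A.mulVecLin := by
    rintro _ ⟨c, rfl⟩
    simp [← mulVec_transpose, h]
  have heq := Submodule.eq_of_le_of_finrank_le hle (by
    have h1 := LinearMap.finrank_range_add_finrank_ker A.mulVecLin
    have h2 : Module.finrank K (LinearMap.range C.vecMulLinear) = Fintype.card l := by
      rw [range_vecMulLinear, ← rank_eq_finrank_span_row, hC.rank_matrix]
    rw [Module.finrank_fintype_fun_eq_card] at h1
    change A.rank + _ = _ at h1
    omega)
  have : u ∈ LinearMap.range C.vecMulLinear := heq ▸ hu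
  exact this

theorem Matrix.exists_vecMul_eq_of_forall_mulVec {A : Matrix m k K} {w : k → K}
    (h : ∀ u, A *ᵥ u = 0 → w ⬝ᵥ u = 0) : ∃ t : m → K, t ᵥ* A = w := by
  classical
  have hmem := mem_span_of_iInf_ker_le_ker (L := fun i => dotProductBilin K K (A i))
    (K := dotProductBilin K K w) (by
      intro u hu
      simp only [Submodule.mem_iInf, LinearMap.mem_ker] at hu
      exact h u (funext hu))
  obtain ⟨t, ht⟩ := (Submodule.mem_span_range_iff_exists_fun K).1 hmem
  refine ⟨t, funext fun j => ?_⟩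
  have := LinearMap.congr_fun ht (Pi.single j 1)
  simpa only [LinearMap.coe_sum, Finset.sum_apply, LinearMap.smul_apply,
    dotProductBilin_apply_apply, dotProduct_single_one, smul_eq_mul] using! this

variable [DecidableEq m]

/-- A left-kernel vector of `A`, depending polynomially on `A` and linearly on `s`, obtained by
correcting a multiple of `s` on the rows `f` by means of Cramer's rule for the minor of `A` with
rows `f` and columns `g`. -/
def cramerKer {r : ℕ} (f : Fin r → m) (g : Fin r → k) (A : Matrix m k K) (s : m → K) : m → K :=
  (A.submatrix f g).det • s -
    ((s ᵥ* A.submatrix id g) ᵥ* (A.submatrix f g).adjugate) ᵥ* (1 : Matrix m m K).submatrix f id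

theorem cramerKer_vecMul {r : ℕ} {f : Fin r → m} {g : Fin r → k} {A : Matrix m k K}
    (h : (A.submatrix f g).det ≠ 0) (hr : A.rank ≤ r) (s : m → K) :
    cramerKer f g A s ᵥ* A = 0 := by
  apply vecMul_eq_zero_of_rank_le h hr
  have : (1 : Matrix m m K).submatrix f id * A.submatrix id g = A.submatrix f g := by
    ext i j
    simp [mul_apply, one_apply]
  rw [cramerKer, sub_vecMul, vecMul_vecMul, this, vecMul_vecMul, adjugate_mul, smul_vecMul,
    vecMul_smul, vecMul_one, sub_self]

omit [Fintype k] in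
theorem cramerKer_of_vecMul_eq_zero {r : ℕ} (f : Fin r → m) (g : Fin r → k) {A : Matrix m k K}
    {s : m → K} (h : s ᵥ* A = 0) : cramerKer f g A s = (A.submatrix f g).det • s := by
  have : s ᵥ* A.submatrix id g = 0 := funext fun j => congrFun h (g j)
  rw [cramerKer, this, zero_vecMul, zero_vecMul, sub_zero]

omit [Fintype k] in
theorem continuous_cramerKer {X : Type*} [TopologicalSpace X] {r : ℕ} (f : Fin r → m)
    (g : Fin r → k) {A : X → Matrix m k ℝ} {s : X → m → ℝ} (hA : Continuous A)
    (hs : Continuous s) : Continuous fun x => cramerKer f g (A x) (s x) := by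
  unfold cramerKer
  fun_prop

end MatrixRank

section RationalPolynomial

variable {X : Type*} (S : Subalgebra ℚ (X → ℝ))

theorem Subalgebra.det_mem {r : ℕ} {M : X → Matrix (Fin r) (Fin r) ℝ}
    (h : ∀ i j, (fun x => M x i j) ∈ S) : (fun x => (M x).det) ∈ S := by
  have : (fun x => (M x).det) = ∑ σ : Equiv.Perm (Fin r),
      ((Equiv.Perm.sign σ : ℤ) : X → ℝ) * ∏ i, fun x => M x (σ i) i := by
    funext x
    simp [Matrix.det_apply']
  rw [this]
  exact sum_mem fun σ _ => mul_mem (intCast_mem _ _) (prod_mem fun i _ => h _ _)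

theorem Subalgebra.ratCast_const_mem (c : ℚ) : (fun _ => (c : ℝ)) ∈ S :=
  S.algebraMap_mem c

theorem Subalgebra.cramerKer_mem {m k : Type*} [Fintype m] [Fintype k] [DecidableEq m] {r : ℕ}
    (f : Fin r → m) (g : Fin r → k) {A : X → Matrix m k ℝ}
    (hA : ∀ i j, (fun x => A x i j) ∈ S) (s : m → ℚ) (i : m) :
    (fun x => cramerKer f g (A x) (fun i => (s i : ℝ)) i) ∈ S := by
  have hs := fun i => S.ratCast_const_mem (s i)
  have hdet : (fun x => ((A x).submatrix f g).det) ∈ S := S.det_mem fun _ _ => hA _ _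
  have hadj : ∀ a b, (fun x => ((A x).submatrix f g).adjugate a b) ∈ S := by
    intro a b
    simp only [Matrix.adjugate_apply]
    refine S.det_mem fun c d => ?_
    by_cases hc : c = b
    · subst hc
      simp only [Matrix.updateRow_self]
      rcases eq_or_ne d a with rfl | hd
      · simp only [Pi.single_eq_same]
        exact S.one_mem
      · simp only [Pi.single_eq_of_ne hd]
        exact S.zero_mem
    · simpa [hc] using hA _ _
  have hfun : (fun x => cramerKer f g (A x) (fun i => (s i : ℝ)) i) =
      (fun x => ((A x).submatrix f g).det) * (fun _ => (s i : ℝ)) -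
        ∑ a, (∑ b, (∑ j, (fun _ => (s j : ℝ)) * fun x => A x j (g b)) *
          fun x => ((A x).submatrix f g).adjugate b a) *
            fun _ => (((1 : Matrix m m ℚ) (f a) i : ℚ) : ℝ) := by
    funext x
    simp [cramerKer, -Matrix.vecMul_vecMul, Matrix.vecMul, dotProduct, Matrix.one_apply,
      apply_ite (Rat.cast : ℚ → ℝ)]
  rw [hfun]
  exact sub_mem (mul_mem hdet (hs i)) (sum_mem fun a _ => mul_mem (sum_mem fun b _ =>
    mul_mem (sum_mem fun j _ => mul_mem (hs j) (hA _ _)) (hadj _ _)) (S.ratCast_const_mem _))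

/-- Polynomial functions with rational coefficients in the coordinates of a configuration. -/
noncomputable def ratPolyFun (n : ℕ) : Subalgebra ℚ ((Fin n → Fin 3 → ℝ) → ℝ) :=
  Algebra.adjoin ℚ (Set.range fun (c : Fin n × Fin 3) p => p c.1 c.2)

theorem coord_mem_ratPolyFun {n : ℕ} (i : Fin n) (a : Fin 3) :
    (fun p => p i a) ∈ ratPolyFun n :=
  Algebra.subset_adjoin ⟨(i, a), rfl⟩

theorem AlgebraicIndependent.ratPolyFun_ne_zero {n : ℕ} {q : Fin n → Fin 3 → ℝ}
    (hq : AlgebraicIndependent ℚ (fun c : Fin n × Fin 3 => q c.1 c.2))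
    {F : (Fin n → Fin 3 → ℝ) → ℝ} (hF : F ∈ ratPolyFun n) {p : Fin n → Fin 3 → ℝ}
    (hp : F p ≠ 0) : F q ≠ 0 := by
  rw [ratPolyFun, Algebra.adjoin_range_eq_range_aeval] at hF
  obtain ⟨P, rfl⟩ := hF
  have heval : ∀ p : Fin n → Fin 3 → ℝ,
      MvPolynomial.aeval (fun (c : Fin n × Fin 3) (p : Fin n → Fin 3 → ℝ) => p c.1 c.2) P p =
        MvPolynomial.aeval (fun c : Fin n × Fin 3 => p c.1 c.2) P := fun p =>
    MvPolynomial.comp_aeval_apply _ (Pi.evalAlgHom ℚ (fun _ => ℝ) p) P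
  simp only [AlgHom.toRingHom_eq_coe, RingHom.coe_coe, heval] at hp ⊢
  intro h
  rw [hq.eq_zero_of_aeval_eq_zero P h] at hp
  simp at hp

/-- At a generic point, the rank of a matrix of rational polynomials is maximal. -/
theorem AlgebraicIndependent.rank_le {n : ℕ} {m k : Type*} [Fintype m] [Fintype k]
    {q : Fin n → Fin 3 → ℝ} (hq : AlgebraicIndependent ℚ (fun c : Fin n × Fin 3 => q c.1 c.2))
    {A : (Fin n → Fin 3 → ℝ) → Matrix m k ℝ} (hA : ∀ i j, (fun p => A p i j) ∈ ratPolyFun n)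
    (p : Fin n → Fin 3 → ℝ) : (A p).rank ≤ (A q).rank := by
  obtain ⟨f, g, h⟩ := (A p).exists_submatrix_det_ne_zero
  exact Matrix.le_rank_of_submatrix_det_ne_zero
    (hq.ratPolyFun_ne_zero ((ratPolyFun n).det_mem
      (M := fun p => (A p).submatrix f g) fun _ _ => hA _ _) h)

end RationalPolynomial

section Framework

open Matrix

variable {n : ℕ} (G : SimpleGraph (Fin n)) [DecidableRel G.Adj]

/-- The edge weights of the stress given by a vector indexed by the rows of the rigidity matrix. -/
def edgeStress (s : Sym2 (Fin n) ⊕ Fin n → ℝ) (i j : Fin n) : ℝ :=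
  if G.Adj i j then s (Sum.inl s(i, j)) else 0

/-- The stress matrix of the stress given by a vector indexed by the rows of the rigidity
matrix. -/
def rowStressMat (s : Sym2 (Fin n) ⊕ Fin n → ℝ) : Matrix (Fin 3 × Fin n) (Fin 3 × Fin n) ℝ :=
  stressMatY (edgeStress G s) (fun i => s (Sum.inr i))

/-- A configuration as a vector indexed by coordinate blocks and vertices. -/
def configVec (p : Fin n → Fin 3 → ℝ) : Fin 3 × Fin n → ℝ := fun c => p c.2 c.1

theorem isStress_edgeStress (s : Sym2 (Fin n) ⊕ Fin n → ℝ) : IsStress G (edgeStress G s) := by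
  refine ⟨fun i j => ?_, fun i j h => if_neg h⟩
  simp only [edgeStress, G.adj_comm i j, Sym2.eq_swap (a := i)]

theorem edgeStress_self (s : Sym2 (Fin n) ⊕ Fin n → ℝ) (i : Fin n) : edgeStress G s i i = 0 :=
  if_neg (G.loopless.irrefl i)

theorem exists_edgeStress_eq {ω : Fin n → Fin n → ℝ} (hω : IsStress G ω) (lam : Fin n → ℝ) :
    ∃ s : Sym2 (Fin n) ⊕ Fin n → ℝ, edgeStress G s = ω ∧ (fun i => s (Sum.inr i)) = lam := by
  refine ⟨Sum.elim (Sym2.lift ⟨ω, hω.1⟩) lam, ?_, rfl⟩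
  funext i j
  by_cases h : G.Adj i j
  · simp [edgeStress, h]
  · simp [edgeStress, h, hω.2 i j h]

theorem stressMatY_mulVec {ω : Fin n → Fin n → ℝ} (hω : ∀ i, ω i i = 0) (lam : Fin n → ℝ)
    (u : Fin 3 × Fin n → ℝ) (a : Fin 3) (i : Fin n) :
    (stressMatY ω lam *ᵥ u) (a, i) =
      (∑ j, ω i j * (u (a, i) - u (a, j))) + lam i * (if a = 2 then 0 else u (a, i)) := by
  have hΩ : ∀ j, omegaMat ω i j = (if i = j then ∑ k, ω i k else 0) - ω i j := by
    intro j
    by_cases h : i = j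
    · subst h
      simp [omegaMat, hω]
    · simp [omegaMat, h]
  rw [mulVec, dotProduct, Fintype.sum_prod_type, Finset.sum_eq_single a]
  · simp only [stressMatY, if_true, hΩ, add_mul, sub_mul, Finset.sum_add_distrib,
      Finset.sum_sub_distrib, mul_sub, ← Finset.sum_mul]
    congr 1
    · simp [ite_mul]
    · by_cases ha : a = 2 <;> simp [ha, ite_mul]
  · intro b _ hb
    simp [stressMatY, hb.symm]
  · simp

theorem stressMatY_transpose {ω : Fin n → Fin n → ℝ} (hω : ∀ i j, ω i j = ω j i)
    (lam : Fin n → ℝ) : (stressMatY ω lam)ᵀ = stressMatY ω lam := by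
  ext ⟨a, i⟩ ⟨b, j⟩
  rcases eq_or_ne a b with rfl | hab
  · rcases eq_or_ne i j with rfl | hij
    · rfl
    · simp [stressMatY, omegaMat, hij, hij.symm, hω i j]
  · simp [stressMatY, hab, hab.symm]

theorem vecMul_rigidityMatY_apply (s : Sym2 (Fin n) ⊕ Fin n → ℝ) (p : Fin n → Fin 3 → ℝ)
    (a : Fin 3) (i : Fin n) : (s ᵥ* rigidityMatY G p) (a, i) =
      (∑ j, edgeStress G s i j * (p i a - p j a)) +
        s (Sum.inr i) * (if a = 2 then 0 else p i a) := by
  rw [vecMul, dotProduct, Fintype.sum_sum_type]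
  congr 1
  · symm
    refine Fintype.sum_of_injective (fun j => s(i, j)) (fun j k h => Sym2.congr_right.1 h) _ _ ?_ ?_
    · intro e he
      have : i ∉ e := fun hi => he ⟨Sym2.Mem.other' hi, Sym2.other_spec' hi⟩
      simp [rigidityMatY, this]
    · intro j
      by_cases h : G.Adj i j
      · have hj : Sym2.Mem.other' (Sym2.mem_mk_left i j) = j :=
          Sym2.congr_right.1 (Sym2.other_spec' (Sym2.mem_mk_left i j))
        simp [edgeStress, rigidityMatY, h, hj]
      · simp [edgeStress, rigidityMatY, h]
  · rw [Finset.sum_eq_single i]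
    · by_cases ha : a = 2 <;> simp [rigidityMatY, ha]
    · intro j _ hj
      simp [rigidityMatY, hj.symm]
    · simp

theorem vecMul_rigidityMatY (s : Sym2 (Fin n) ⊕ Fin n → ℝ) (p : Fin n → Fin 3 → ℝ) :
    s ᵥ* rigidityMatY G p = rowStressMat G s *ᵥ configVec p := by
  funext ⟨a, i⟩
  rw [vecMul_rigidityMatY_apply, rowStressMat, stressMatY_mulVec (edgeStress_self G s)]
  rfl

theorem isEquilStressY_iff (s : Sym2 (Fin n) ⊕ Fin n → ℝ) (p : Fin n → Fin 3 → ℝ) :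
    IsEquilStressY p (edgeStress G s) (fun i => s (Sum.inr i)) ↔ s ᵥ* rigidityMatY G p = 0 := by
  simp only [funext_iff, Prod.forall, vecMul_rigidityMatY_apply, IsEquilStressY, Pi.zero_apply]
  exact forall_comm

theorem rigidityMatY_add_smul (p v : Fin n → Fin 3 → ℝ) (t : ℝ) :
    rigidityMatY G (p + t • v) = rigidityMatY G p + t • rigidityMatY G v := by
  ext (e | i) c
  · simp only [rigidityMatY, Pi.add_apply, Pi.smul_apply, smul_eq_mul, Matrix.add_apply,
      Matrix.smul_apply]
    split_ifs <;> ring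
  · simp only [rigidityMatY, Pi.add_apply, Pi.smul_apply, smul_eq_mul, Matrix.add_apply,
      Matrix.smul_apply]
    split_ifs <;> ring

theorem rigidityMatY_mem_ratPolyFun (e : Sym2 (Fin n) ⊕ Fin n) (c : Fin 3 × Fin n) :
    (fun p => rigidityMatY G p e c) ∈ ratPolyFun n := by
  rcases e with e | i
  · by_cases he : e ∈ G.edgeSet
    · by_cases hc : c.2 ∈ e
      · simp only [rigidityMatY, he, hc, if_true, dif_pos]
        exact sub_mem (coord_mem_ratPolyFun _ _) (coord_mem_ratPolyFun _ _)
      · simp only [rigidityMatY, he, hc, if_true]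
        exact zero_mem _
    · simp only [rigidityMatY, he, if_false]
      exact zero_mem _
  · by_cases h : c.2 = i ∧ c.1 ≠ 2
    · simp only [rigidityMatY, if_pos h]
      exact coord_mem_ratPolyFun _ _
    · simp only [rigidityMatY, if_neg h]
      exact zero_mem _

theorem continuous_rowStressMat : Continuous (rowStressMat G) := by
  refine continuous_matrix fun r c => ?_
  have h : ∀ i j, Continuous fun s => edgeStress G s i j := fun i j => by
    unfold edgeStress
    split_ifs <;> fun_prop
  unfold rowStressMat stressMatY omegaMat
  split_ifs <;> fun_prop

theorem rowStressMat_smul (t : ℝ) (s : Sym2 (Fin n) ⊕ Fin n → ℝ) :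
    rowStressMat G (t • s) = t • rowStressMat G s := by
  ext r c
  have h : ∀ i j, edgeStress G (t • s) i j = t * edgeStress G s i j := fun i j => by
    simp [edgeStress]
  simp only [rowStressMat, stressMatY, omegaMat, h, Pi.smul_apply, smul_eq_mul, Matrix.smul_apply,
    ← Finset.mul_sum]
  split_ifs <;> ring

theorem rowStressMat_mem {X : Type*} (S : Subalgebra ℚ (X → ℝ))
    {s : X → Sym2 (Fin n) ⊕ Fin n → ℝ} (hs : ∀ e, (fun x => s x e) ∈ S) (r c : Fin 3 × Fin n) :
    (fun x => rowStressMat G (s x) r c) ∈ S := by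
  have hedge : ∀ i j, (fun x => edgeStress G (s x) i j) ∈ S := fun i j => by
    unfold edgeStress
    split_ifs
    exacts [hs _, zero_mem _]
  have homega : ∀ i j, (fun x => omegaMat (edgeStress G (s x)) i j) ∈ S := fun i j => by
    unfold omegaMat
    split_ifs
    · have : (fun x => ∑ k, edgeStress G (s x) i k) = ∑ k, fun x => edgeStress G (s x) i k := by
        funext x
        simp
      rw [this]
      exact sum_mem fun k _ => hedge i k
    · exact neg_mem (hedge i j)
  unfold rowStressMat stressMatY
  split_ifs
  · exact add_mem (homega _ _) (hs _)
  · exact add_mem (homega _ _) (zero_mem _)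
  · exact zero_mem _

/-- At a generic point, every equilibrium stress annihilates the infinitesimal motions. -/
theorem AlgebraicIndependent.rowStressMat_mulVec_eq_zero {q : Fin n → Fin 3 → ℝ}
    (hq : AlgebraicIndependent ℚ (fun c : Fin n × Fin 3 => q c.1 c.2))
    {s : Sym2 (Fin n) ⊕ Fin n → ℝ} (hs : s ᵥ* rigidityMatY G q = 0)
    {u : Fin 3 × Fin n → ℝ} (hu : rigidityMatY G q *ᵥ u = 0) :
    rowStressMat G s *ᵥ u = 0 := by
  obtain ⟨f, g, hfg⟩ := (rigidityMatY G q).exists_submatrix_det_ne_zero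
  have key : ∀ v : Fin n → Fin 3 → ℝ, s ᵥ* rigidityMatY G v ⬝ᵥ u = 0 := by
    intro v
    have hR : Continuous fun t : ℝ => rigidityMatY G (q + t • v) := by
      simp only [rigidityMatY_add_smul]
      fun_prop
    let w : ℝ → Sym2 (Fin n) ⊕ Fin n → ℝ := fun t => cramerKer f g (rigidityMatY G (q + t • v)) s
    have hw : Continuous w := continuous_cramerKer f g hR continuous_const
    have hdet : ∀ᶠ t : ℝ in nhds 0, ((rigidityMatY G (q + t • v)).submatrix f g).det ≠ 0 := by
      refine ContinuousAt.eventually_ne ?_ (by simpa using hfg)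
      exact Continuous.continuousAt (by fun_prop)
    have hzero : ∀ᶠ t : ℝ in nhdsWithin 0 {0}ᶜ, w t ᵥ* rigidityMatY G v ⬝ᵥ u = 0 := by
      filter_upwards [hdet.filter_mono nhdsWithin_le_nhds, self_mem_nhdsWithin] with t ht ht0
      have h0 : w t ᵥ* rigidityMatY G (q + t • v) = 0 :=
        cramerKer_vecMul ht (hq.rank_le (rigidityMatY_mem_ratPolyFun G) _) s
      have h1 : w t ᵥ* rigidityMatY G (q + t • v) ⬝ᵥ u = 0 := by rw [h0, zero_dotProduct]
      rw [← dotProduct_mulVec, rigidityMatY_add_smul, add_mulVec, hu, zero_add, smul_mulVec,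
        dotProduct_smul, dotProduct_mulVec, smul_eq_mul] at h1
      exact (mul_eq_zero.1 h1).resolve_left ht0
    have hlim : Filter.Tendsto (fun t => w t ᵥ* rigidityMatY G v ⬝ᵥ u) (nhdsWithin 0 {0}ᶜ)
        (nhds (w 0 ᵥ* rigidityMatY G v ⬝ᵥ u)) := by
      refine (Continuous.tendsto ?_ 0).mono_left nhdsWithin_le_nhds
      fun_prop
    have h0 : w 0 ᵥ* rigidityMatY G v ⬝ᵥ u = 0 :=
      tendsto_nhds_unique (hlim.congr' hzero) tendsto_const_nhds
    have hw0 : w 0 = ((rigidityMatY G q).submatrix f g).det • s := by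
      simp only [w, zero_smul, add_zero]
      exact cramerKer_of_vecMul_eq_zero f g hs
    rw [hw0, smul_vecMul, smul_dotProduct, smul_eq_mul] at h0
    exact (mul_eq_zero.1 h0).resolve_left hfg
  have hsymm : (rowStressMat G s)ᵀ = rowStressMat G s :=
    stressMatY_transpose (isStress_edgeStress G s).1 _
  refine dotProduct_eq_zero _ fun v => ?_
  rw [dotProduct_comm, dotProduct_mulVec, ← mulVec_transpose, hsymm]
  have := key fun i a => v (a, i)
  rwa [vecMul_rigidityMatY] at this

/-- A stress matrix of maximal rank on a framework of maximal rigidity-matrix rank transfers to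
generic points. -/
theorem AlgebraicIndependent.exists_rank_le_rowStressMat {q : Fin n → Fin 3 → ℝ}
    (hq : AlgebraicIndependent ℚ (fun c : Fin n × Fin 3 => q c.1 c.2)) {p : Fin n → Fin 3 → ℝ}
    (hpq : (rigidityMatY G q).rank ≤ (rigidityMatY G p).rank)
    {s : Sym2 (Fin n) ⊕ Fin n → ℝ} (hs : s ᵥ* rigidityMatY G p = 0) :
    ∃ s' : Sym2 (Fin n) ⊕ Fin n → ℝ, s' ᵥ* rigidityMatY G q = 0 ∧
      (rowStressMat G s).rank ≤ (rowStressMat G s').rank := by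
  obtain ⟨f, g, hfg⟩ := (rigidityMatY G p).exists_submatrix_det_ne_zero
  obtain ⟨f', g', hfg'⟩ := (rowStressMat G s).exists_submatrix_det_ne_zero
  let F : (Fin n → Fin 3 → ℝ) → (Sym2 (Fin n) ⊕ Fin n → ℝ) → ℝ := fun x t =>
    ((rowStressMat G (cramerKer f g (rigidityMatY G x) t)).submatrix f' g').det
  have hFs : F p s ≠ 0 := by
    simp only [F, cramerKer_of_vecMul_eq_zero f g hs, rowStressMat_smul]
    rw [submatrix_smul, Pi.smul_apply, Pi.smul_apply, det_smul]
    exact mul_ne_zero (pow_ne_zero _ hfg) hfg'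
  have hcont : Continuous (F p) := by
    have h1 : Continuous fun t => cramerKer f g (rigidityMatY G p) t :=
      continuous_cramerKer f g continuous_const continuous_id
    have := (continuous_rowStressMat G).comp h1
    exact (this.matrix_submatrix f' g').matrix_det
  obtain ⟨t, ht⟩ : ∃ t : Sym2 (Fin n) ⊕ Fin n → ℚ, F p (fun e => (t e : ℝ)) ≠ 0 := by
    have hdense : DenseRange (Pi.map fun (_ : Sym2 (Fin n) ⊕ Fin n) (x : ℚ) => (x : ℝ)) :=
      DenseRange.piMap fun _ => Rat.denseRange_cast
    exact hdense.exists_mem_open (isOpen_ne_fun hcont continuous_const) ⟨s, hFs⟩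
  have hmem : (fun x => F x fun e => (t e : ℝ)) ∈ ratPolyFun n :=
    (ratPolyFun n).det_mem fun _ _ => rowStressMat_mem G _
      (fun e => (ratPolyFun n).cramerKer_mem f g (rigidityMatY_mem_ratPolyFun G) t e) _ _
  have hdet : ((rigidityMatY G q).submatrix f g).det ≠ 0 :=
    hq.ratPolyFun_ne_zero ((ratPolyFun n).det_mem (M := fun x => (rigidityMatY G x).submatrix f g)
      fun _ _ => rigidityMatY_mem_ratPolyFun G _ _) hfg
  exact ⟨_, cramerKer_vecMul hdet hpq _,
    le_rank_of_submatrix_det_ne_zero (hq.ratPolyFun_ne_zero hmem ht)⟩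

end Framework

theorem Submodule.exists_mem_forall_ne_zero {ι : Type*} [Finite ι] (V : Submodule ℝ (ι → ℝ))
    (T : Finset ι) (hT : ∀ e ∈ T, ∃ s ∈ V, s e ≠ 0) {U : Set (ι → ℝ)} (hU : IsOpen U)
    {s : ι → ℝ} (hsV : s ∈ V) (hsU : s ∈ U) : ∃ t ∈ V, t ∈ U ∧ ∀ e ∈ T, t e ≠ 0 := by
  classical
  induction T using Finset.induction_on with
  | empty => exact ⟨s, hsV, hsU, by simp⟩
  | insert e T _ ih =>
    obtain ⟨t, htV, htU, htT⟩ := ih fun e' he' => hT e' (mem_insert_of_mem he')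
    obtain ⟨v, hvV, hve⟩ := hT e (mem_insert_self _ _)
    by_cases hte : t e = 0
    · have hline : Continuous fun ε : ℝ => t + ε • v := by fun_prop
      have h1 : ∀ᶠ ε : ℝ in nhds 0, t + ε • v ∈ U :=
        hline.continuousAt.eventually_mem (by simpa using hU.mem_nhds htU)
      have h2 : ∀ᶠ ε : ℝ in nhds 0, ∀ e' ∈ T, (t + ε • v) e' ≠ 0 := by
        rw [Filter.eventually_all_finset]
        intro e' he'
        exact ((continuous_apply e').comp hline).continuousAt.eventually_ne
          (by simpa using htT e' he')
      obtain ⟨ε, ⟨h1, h2⟩, hε⟩ := (((h1.and h2).filter_mono nhdsWithin_le_nhds).and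
        (self_mem_nhdsWithin (s := {(0 : ℝ)}ᶜ))).exists
      refine ⟨t + ε • v, add_mem htV (V.smul_mem _ hvV), h1, ?_⟩
      rw [forall_mem_insert]
      exact ⟨by simpa [hte] using ⟨hε, hve⟩, h2⟩
    · exact ⟨t, htV, htU, (forall_mem_insert _ _ _).2 ⟨hte, htT⟩⟩

section Framework

open Matrix

variable {n : ℕ} (G : SimpleGraph (Fin n)) [DecidableRel G.Adj]

/-- The two infinitesimal isometries of the cylinders: the rotation about and the translation
along the axis. -/
def isometryMat (p : Fin n → Fin 3 → ℝ) : Matrix (Fin 2) (Fin 3 × Fin n) ℝ :=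
  Matrix.of ![
    fun c => if c.1 = 0 then p c.2 1 else if c.1 = 1 then -p c.2 0 else 0,
    fun c => if c.1 = 2 then 1 else 0]

theorem rigidityMatY_mulVec_inl (p : Fin n → Fin 3 → ℝ) (u : Fin 3 × Fin n → ℝ) {i j : Fin n}
    (h : G.Adj i j) : (rigidityMatY G p *ᵥ u) (Sum.inl s(i, j)) =
      ∑ a, (p i a - p j a) * (u (a, i) - u (a, j)) := by
  rw [mulVec, dotProduct, Fintype.sum_prod_type]
  refine Finset.sum_congr rfl fun a _ => ?_
  have hi : Sym2.Mem.other' (Sym2.mem_mk_left i j) = j :=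
    Sym2.congr_right.1 (Sym2.other_spec' (Sym2.mem_mk_left i j))
  have hj : Sym2.Mem.other' (Sym2.mem_mk_right i j) = i :=
    Sym2.congr_right.1 ((Sym2.other_spec' (Sym2.mem_mk_right i j)).trans Sym2.eq_swap)
  rw [Fintype.sum_eq_add i j h.ne]
  · simp [rigidityMatY, h, hi, hj]
    ring
  · rintro k ⟨hki, hkj⟩
    simp [rigidityMatY, hki, hkj]

theorem rigidityMatY_mulVec_inl_of_notMem (p : Fin n → Fin 3 → ℝ) (u : Fin 3 × Fin n → ℝ)
    {e : Sym2 (Fin n)} (h : e ∉ G.edgeSet) : (rigidityMatY G p *ᵥ u) (Sum.inl e) = 0 := by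
  simp [mulVec, dotProduct, rigidityMatY, h]

theorem rigidityMatY_mulVec_inr (p : Fin n → Fin 3 → ℝ) (u : Fin 3 × Fin n → ℝ) (i : Fin n) :
    (rigidityMatY G p *ᵥ u) (Sum.inr i) = p i 0 * u (0, i) + p i 1 * u (1, i) := by
  rw [mulVec, dotProduct, Fintype.sum_prod_type, Fin.sum_univ_three]
  simp [rigidityMatY, ite_mul]

theorem rigidityMatY_mul_isometryMat_transpose (p : Fin n → Fin 3 → ℝ) :
    rigidityMatY G p * (isometryMat p)ᵀ = 0 := by
  have key : ∀ k, rigidityMatY G p *ᵥ isometryMat p k = 0 := by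
    intro k
    funext e
    rcases e with e | i
    · by_cases he : e ∈ G.edgeSet
      · induction e with | _ i j
        rw [rigidityMatY_mulVec_inl G p _ he, Fin.sum_univ_three]
        fin_cases k <;> simp [isometryMat]
        ring
      · exact rigidityMatY_mulVec_inl_of_notMem G p _ he
    · rw [rigidityMatY_mulVec_inr]
      fin_cases k <;> simp [isometryMat]
      ring
  ext e k
  exact congrFun (key k) e

theorem linearIndependent_isometryMat {p : Fin n → Fin 3 → ℝ} {i : Fin n} (hi : p i 0 ≠ 0) :
    LinearIndependent ℝ (isometryMat p).row := by
  rw [Fintype.linearIndependent_iff]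
  intro c hc
  have h1 := congrFun hc (1, i)
  have h2 := congrFun hc (2, i)
  simp [isometryMat, row, Fin.sum_univ_two, hi] at h1 h2
  intro k
  fin_cases k
  exacts [h1, h2]

theorem linearIndependent_configMatY {p : Fin n → Fin 3 → ℝ} {i j : Fin n}
    (hdet : p i 0 * p j 1 - p j 0 * p i 1 ≠ 0) (hz : p i 2 ≠ p j 2) :
    LinearIndependent ℝ (configMatY p).row := by
  rw [Fintype.linearIndependent_iff]
  intro c hc
  have h := fun a k => congrFun hc (a, k)
  have h0i := h 0 i
  have h0j := h 0 j
  have h1i := h 1 i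
  have h1j := h 1 j
  have h2i := h 2 i
  have h2j := h 2 j
  simp [configMatY, row, Fin.sum_univ_six] at h0i h0j h1i h1j h2i h2j
  have hz' : p i 2 - p j 2 ≠ 0 := sub_ne_zero.2 hz
  have c0 : c 0 = 0 := (mul_eq_zero.1 (by linear_combination p j 1 * h0i - p i 1 * h0j :
    c 0 * (p i 0 * p j 1 - p j 0 * p i 1) = 0)).resolve_right hdet
  have c3 : c 3 = 0 := (mul_eq_zero.1 (by linear_combination p i 0 * h0j - p j 0 * h0i :
    c 3 * (p i 0 * p j 1 - p j 0 * p i 1) = 0)).resolve_right hdet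
  have c4 : c 4 = 0 := (mul_eq_zero.1 (by linear_combination p j 1 * h1i - p i 1 * h1j :
    c 4 * (p i 0 * p j 1 - p j 0 * p i 1) = 0)).resolve_right hdet
  have c1 : c 1 = 0 := (mul_eq_zero.1 (by linear_combination p i 0 * h1j - p j 0 * h1i :
    c 1 * (p i 0 * p j 1 - p j 0 * p i 1) = 0)).resolve_right hdet
  have c2 : c 2 = 0 := (mul_eq_zero.1 (by linear_combination h2i - h2j :
    c 2 * (p i 2 - p j 2) = 0)).resolve_right hz'
  have c5 : c 5 = 0 := by linear_combination h2i - p i 2 * c2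
  intro k
  fin_cases k <;> assumption

theorem rowStressMat_mul_configMatY_transpose {p : Fin n → Fin 3 → ℝ}
    {s : Sym2 (Fin n) ⊕ Fin n → ℝ} (hs : s ᵥ* rigidityMatY G p = 0) :
    rowStressMat G s * (configMatY p)ᵀ = 0 := by
  have h : ∀ a i, _ := fun a i =>
    (vecMul_rigidityMatY_apply G s p a i).symm.trans (congrFun hs (a, i))
  have key : ∀ k, rowStressMat G s *ᵥ configMatY p k = 0 := by
    intro k
    funext ⟨a, i⟩
    rw [rowStressMat, stressMatY_mulVec (edgeStress_self G s)]
    have h0 := h 0 i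
    have h1 := h 1 i
    have h2 := h 2 i
    simp at h0 h1 h2
    fin_cases k <;> fin_cases a <;> simp [configMatY, h0, h1, h2]
  ext c k
  exact congrFun (key k) c

theorem AlgebraicIndependent.det_ne_zero {q : Fin n → Fin 3 → ℝ}
    (hq : AlgebraicIndependent ℚ (fun c : Fin n × Fin 3 => q c.1 c.2)) {i j : Fin n}
    (hij : i ≠ j) : q i 0 * q j 1 - q j 0 * q i 1 ≠ 0 := by
  have hx := fun i : Fin n => coord_mem_ratPolyFun i (0 : Fin 3)
  have hy := fun i : Fin n => coord_mem_ratPolyFun i (1 : Fin 3)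
  refine hq.ratPolyFun_ne_zero (sub_mem (mul_mem (hx i) (hy j)) (mul_mem (hx j) (hy i)))
    (p := fun k a => if a = 0 then if k = i then 1 else 0 else 1) ?_
  simp [hij.symm]

theorem exists_adj_of_rowStressMat_ne_zero {p : Fin n → Fin 3 → ℝ} (hp : ∀ i, p i 0 ≠ 0)
    {s : Sym2 (Fin n) ⊕ Fin n → ℝ} (hs : s ᵥ* rigidityMatY G p = 0)
    (hne : rowStressMat G s ≠ 0) : ∃ i j, G.Adj i j := by
  by_contra! hG
  have hedge : ∀ i j, edgeStress G s i j = 0 := fun i j => if_neg (hG i j)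
  have hlam : ∀ i, s (Sum.inr i) = 0 := fun i => by
    have h := (vecMul_rigidityMatY_apply G s p 0 i).symm.trans (congrFun hs (0, i))
    simpa [hedge, hp] using h
  refine hne ?_
  ext r c
  simp [rowStressMat, stressMatY, omegaMat, hedge, hlam]

theorem binary_quadratic_eq_zero {α β γ x₀ y₀ x₁ y₁ x₂ y₂ : ℝ} (hy₀ : y₀ ≠ 0) (hy₁ : y₁ ≠ 0)
    (h01 : x₀ * y₁ - x₁ * y₀ ≠ 0) (h02 : x₀ * y₂ - x₂ * y₀ ≠ 0) (h12 : x₁ * y₂ - x₂ * y₁ ≠ 0)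
    (e₀ : α * x₀ ^ 2 + β * (x₀ * y₀) + γ * y₀ ^ 2 = 0)
    (e₁ : α * x₁ ^ 2 + β * (x₁ * y₁) + γ * y₁ ^ 2 = 0)
    (e₂ : α * x₂ ^ 2 + β * (x₂ * y₂) + γ * y₂ ^ 2 = 0) : α = 0 ∧ β = 0 ∧ γ = 0 := by
  have A : α * (x₀ * y₁ + x₁ * y₀) + β * (y₀ * y₁) = 0 :=
    (mul_eq_zero.1 (by linear_combination y₁ ^ 2 * e₀ - y₀ ^ 2 * e₁ :
      (x₀ * y₁ - x₁ * y₀) * (α * (x₀ * y₁ + x₁ * y₀) + β * (y₀ * y₁)) = 0)).resolve_left h01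
  have B : α * (x₀ * y₂ + x₂ * y₀) + β * (y₀ * y₂) = 0 :=
    (mul_eq_zero.1 (by linear_combination y₂ ^ 2 * e₀ - y₀ ^ 2 * e₂ :
      (x₀ * y₂ - x₂ * y₀) * (α * (x₀ * y₂ + x₂ * y₀) + β * (y₀ * y₂)) = 0)).resolve_left h02
  have hα : α = 0 := (mul_eq_zero.1 (by linear_combination y₂ * A - y₁ * B :
    α * (y₀ * (x₁ * y₂ - x₂ * y₁)) = 0)).resolve_right (mul_ne_zero hy₀ h12)
  subst hα
  have hβ : β = 0 := (mul_eq_zero.1 (by linear_combination A :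
    β * (y₀ * y₁) = 0)).resolve_right (mul_ne_zero hy₀ hy₁)
  subst hβ
  exact ⟨rfl, rfl, (mul_eq_zero.1 (by linear_combination e₀ : γ * y₀ ^ 2 = 0)).resolve_right
    (pow_ne_zero _ hy₀)⟩

/-- A generic framework with a stress matrix of maximal rank is infinitesimally rigid. -/
theorem AlgebraicIndependent.exists_vecMul_isometryMat_eq (hn : 3 ≤ n) {q : Fin n → Fin 3 → ℝ}
    (hq : AlgebraicIndependent ℚ (fun c : Fin n × Fin 3 => q c.1 c.2))
    {s : Sym2 (Fin n) ⊕ Fin n → ℝ} (hs : s ᵥ* rigidityMatY G q = 0)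
    (hrank : 3 * n - 6 ≤ (rowStressMat G s).rank) (hne : rowStressMat G s ≠ 0)
    {u : Fin 3 × Fin n → ℝ} (hu : rigidityMatY G q *ᵥ u = 0) :
    ∃ c : Fin 2 → ℝ, c ᵥ* isometryMat q = u := by
  have hcoord : ∀ i a, q i a ≠ 0 := fun i a => hq.ne_zero (i, a)
  have hz : ∀ i j, i ≠ j → q i 2 ≠ q j 2 := fun i j hij h =>
    hij (Prod.ext_iff.1 (hq.injective (a₁ := (i, 2)) (a₂ := (j, 2)) h)).1
  let v : Fin 3 → Fin n := Fin.castLE hn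
  have hv : ∀ {i j}, i ≠ j → v i ≠ v j := fun h h' => h (Fin.castLE_injective hn h')
  have hdet : ∀ {i j}, i ≠ j → q (v i) 0 * q (v j) 1 - q (v j) 0 * q (v i) 1 ≠ 0 := fun h =>
    hq.det_ne_zero (hv h)
  have h01 : (0 : Fin 3) ≠ 1 := by decide
  have h02 : (0 : Fin 3) ≠ 2 := by decide
  have h12 : (1 : Fin 3) ≠ 2 := by decide
  obtain ⟨c, hc⟩ := exists_vecMul_eq_of_mulVec_eq_zero
    (linearIndependent_configMatY (hdet h01) (hz _ _ (hv h01)))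
    (rowStressMat_mul_configMatY_transpose G hs) (by simp; omega)
    (hq.rowStressMat_mulVec_eq_zero G hs hu)
  have hu0 : ∀ i, u (0, i) = c 0 * q i 0 + c 3 * q i 1 := fun i => by
    rw [← hc]
    simp [configMatY, vecMul, dotProduct, Fin.sum_univ_six]
  have hu1 : ∀ i, u (1, i) = c 1 * q i 1 + c 4 * q i 0 := fun i => by
    rw [← hc]
    simp [configMatY, vecMul, dotProduct, Fin.sum_univ_six]
  have hu2 : ∀ i, u (2, i) = c 2 * q i 2 + c 5 := fun i => by
    rw [← hc]
    simp [configMatY, vecMul, dotProduct, Fin.sum_univ_six]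
  have hquad : ∀ i, c 0 * q i 0 ^ 2 + (c 3 + c 4) * (q i 0 * q i 1) + c 1 * q i 1 ^ 2 = 0 := by
    intro i
    have h := (rigidityMatY_mulVec_inr G q u i).symm.trans (congrFun hu _)
    rw [hu0, hu1] at h
    simp only [Pi.zero_apply] at h
    linear_combination h
  obtain ⟨hc0, hc34, hc1⟩ := binary_quadratic_eq_zero (hcoord _ _) (hcoord _ _) (hdet h01)
    (hdet h02) (hdet h12) (hquad (v 0)) (hquad (v 1)) (hquad (v 2))
  have hc4 : c 4 = -c 3 := by linear_combination hc34
  obtain ⟨i, j, hij⟩ := exists_adj_of_rowStressMat_ne_zero G (fun i => hcoord i 0) hs hne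
  have hc2 : c 2 = 0 := by
    have h := (rigidityMatY_mulVec_inl G q u hij).symm.trans (congrFun hu _)
    simp only [Fin.sum_univ_three, hu0, hu1, hu2, hc0, hc1, hc4, Pi.zero_apply] at h
    have h' : c 2 * (q i 2 - q j 2) ^ 2 = 0 := by linear_combination h
    exact (mul_eq_zero.1 h').resolve_right (pow_ne_zero _ (sub_ne_zero.2 (hz i j hij.ne)))
  refine ⟨![c 3, c 5], ?_⟩
  funext ⟨a, i⟩
  fin_cases a
  · simp [isometryMat, vecMul, dotProduct, hu0, hc0]
  · simp [isometryMat, vecMul, dotProduct, hu1, hc1, hc4]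
  · simp [isometryMat, vecMul, dotProduct, hu2, hc2]

/-- If a generic framework has a stress matrix of maximal rank, then every edge coordinate is
nonzero in some equilibrium stress. -/
theorem AlgebraicIndependent.exists_stress_ne_zero (hn : 3 ≤ n) {q : Fin n → Fin 3 → ℝ}
    (hq : AlgebraicIndependent ℚ (fun c : Fin n × Fin 3 => q c.1 c.2))
    {s : Sym2 (Fin n) ⊕ Fin n → ℝ} (hs : s ᵥ* rigidityMatY G q = 0)
    (hrank : 3 * n - 6 ≤ (rowStressMat G s).rank) (hne : rowStressMat G s ≠ 0)
    (e : Sym2 (Fin n)) :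
    ∃ t : Sym2 (Fin n) ⊕ Fin n → ℝ, t ᵥ* rigidityMatY G q = 0 ∧ t (Sum.inl e) ≠ 0 := by
  classical
  by_cases hse : s (Sum.inl e) = 0
  swap
  · exact ⟨s, hs, hse⟩
  let H := G.deleteEdges {e}
  have hstress : rowStressMat H s = rowStressMat G s := by
    have : edgeStress H s = edgeStress G s := by
      funext i j
      simp only [edgeStress, H, SimpleGraph.deleteEdges_adj, Set.mem_singleton_iff]
      by_cases h : s(i, j) = e <;> simp [h, hse]
    rw [rowStressMat, rowStressMat, this]
  have hrow : rigidityMatY H q = (rigidityMatY G q).updateRow (Sum.inl e) 0 := by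
    ext (e' | i) c
    · by_cases h : e' = e
      · simp [rigidityMatY, H, h]
      · simp [rigidityMatY, H, h]
    · simp [rigidityMatY]
  have hsH : s ᵥ* rigidityMatY H q = 0 := by
    rw [vecMul_rigidityMatY, hstress, ← vecMul_rigidityMatY, hs]
  obtain ⟨t, ht⟩ := exists_vecMul_eq_of_forall_mulVec (A := rigidityMatY H q)
    (w := rigidityMatY G q (Sum.inl e)) (by
      intro u hu
      obtain ⟨c, rfl⟩ := hq.exists_vecMul_isometryMat_eq H hn hsH (hstress ▸ hrank)
        (hstress ▸ hne) hu
      have : rigidityMatY G q *ᵥ (c ᵥ* isometryMat q) = 0 := by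
        rw [← mulVec_transpose, mulVec_mulVec, rigidityMatY_mul_isometryMat_transpose, zero_mulVec]
      exact congrFun this (Sum.inl e))
  refine ⟨Pi.single (Sum.inl e) 1 - Function.update t (Sum.inl e) 0, ?_, by simp⟩
  have hupd : Function.update t (Sum.inl e) 0 ᵥ* rigidityMatY G q = t ᵥ* rigidityMatY H q := by
    funext c
    simp only [vecMul, dotProduct, hrow]
    refine Finset.sum_congr rfl fun e' _ => ?_
    by_cases h : e' = Sum.inl e
    · simp [h]
    · simp [h]
  rw [sub_vecMul, hupd, ht, single_one_vecMul]
  exact sub_self _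

end Framework

theorem rank_rigidityMatY_le_three (G : SimpleGraph (Fin 2)) [DecidableRel G.Adj]
    (p : Fin 2 → Fin 3 → ℝ) : (rigidityMatY G p).rank ≤ 3 := by
  refine (Matrix.rank_le_card_of_support_subset _
    {Sum.inl s(0, 1), Sum.inr 0, Sum.inr 1} ?_).trans Finset.card_le_three
  rintro (e | i) h
  · have he : e ∈ G.edgeSet := by
      by_contra he
      refine h ?_
      funext c
      simp [Matrix.row, rigidityMatY, he]
    induction e with | _ i j
    have hij : i ≠ j := G.ne_of_adj he
    fin_cases i <;> fin_cases j <;> simp at hij ⊢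
  · fin_cases i <;> simp

theorem stmt16 (n : ℕ) (G : SimpleGraph (Fin n)) [DecidableRel G.Adj]
    (r : Fin n → ℝ) (hr : ∀ i, 0 < r i)
    (p : Fin n → Fin 3 → ℝ) (hp : ∀ i, (p i 0) ^ 2 + (p i 1) ^ 2 = r i)
    (hrig : (rigidityMatY G p).rank = 3 * n - 2)
    (ω : Fin n → Fin n → ℝ) (lam : Fin n → ℝ) (hω : IsStress G ω)
    (hequil : IsEquilStressY p ω lam)
    (hrank : (stressMatY ω lam).rank = 3 * n - 6)
    (q : Fin n → Fin 3 → ℝ)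
    (hgen : AlgebraicIndependent ℚ (fun c : Fin n × Fin 3 => q c.1 c.2)) :
    ∃ ω' : Fin n → Fin n → ℝ, ∃ lam' : Fin n → ℝ,
      IsStress G ω' ∧ IsEquilStressY q ω' lam' ∧
      (stressMatY ω' lam').rank = 3 * n - 6 ∧
      ∀ i j, G.Adj i j → ω' i j ≠ 0 := by
  rcases lt_or_ge n 2 with hn | hn
  · have hsub : Subsingleton (Fin n) := Fin.subsingleton_iff_le_one.2 (by omega)
    refine ⟨0, 0, by simp [IsStress], by simp [IsEquilStressY], ?_,
      fun i j h => absurd (Subsingleton.elim i j) h.ne⟩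
    have h0 : stressMatY (0 : Fin n → Fin n → ℝ) 0 = 0 := by
      ext r c
      simp [stressMatY, omegaMat]
    rw [h0, Matrix.rank_zero]
    omega
  rcases hn.eq_or_lt with rfl | hn
  · have := rank_rigidityMatY_le_three G p
    omega
  have hn : 3 ≤ n := hn
  obtain ⟨s, rfl, rfl⟩ := exists_edgeStress_eq G hω lam
  have hx : ∀ i, q i 0 ≠ 0 := fun i => hgen.ne_zero (i, 0)
  have hle := Matrix.rank_add_card_le_of_mul_transpose_eq_zero
    (linearIndependent_isometryMat (hx ⟨0, by omega⟩)) (rigidityMatY_mul_isometryMat_transpose G q)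
  simp only [Fintype.card_fin, Fintype.card_prod] at hle
  obtain ⟨t, ht, htrank⟩ := hgen.exists_rank_le_rowStressMat G (by omega)
    ((isEquilStressY_iff G s p).1 hequil)
  rw [rowStressMat, hrank] at htrank
  have htne : rowStressMat G t ≠ 0 := by
    intro h0
    rw [h0, Matrix.rank_zero] at htrank
    omega
  obtain ⟨f, g, hfg⟩ := (rowStressMat G t).exists_submatrix_det_ne_zero
  have hopen : IsOpen {s | ((rowStressMat G s).submatrix f g).det ≠ 0} :=
    isOpen_ne_fun (((continuous_rowStressMat G).matrix_submatrix f g).matrix_det)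
      continuous_const
  obtain ⟨w, hwV, hwU, hwE⟩ := Submodule.exists_mem_forall_ne_zero
    (LinearMap.ker (rigidityMatY G q).vecMulLinear) (Finset.univ.map Function.Embedding.inl)
    (by simpa using hgen.exists_stress_ne_zero G hn ht htrank htne)
    hopen ht hfg
  refine ⟨edgeStress G w, fun i => w (Sum.inr i), isStress_edgeStress G w,
    (isEquilStressY_iff G w q).2 hwV, le_antisymm ?_
      (htrank.trans (Matrix.le_rank_of_submatrix_det_ne_zero hwU)), ?_⟩
  · have hij : (⟨0, by omega⟩ : Fin n) ≠ ⟨1, by omega⟩ := by simp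
    have := Matrix.rank_add_card_le_of_mul_transpose_eq_zero
      (linearIndependent_configMatY (hgen.det_ne_zero hij) fun h =>
        hij (Prod.ext_iff.1 (hgen.injective (a₁ := (_, 2)) (a₂ := (_, 2)) h)).1)
      (rowStressMat_mul_configMatY_transpose G hwV)
    simp only [Fintype.card_fin, Fintype.card_prod, rowStressMat] at this
    omega
  · intro i j hij
    rw [edgeStress, if_pos hij]
    exact hwE _ (Finset.mem_map_of_mem _ (Finset.mem_univ _))
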